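/- arXiv:1801.09837 — 6 statements merged into one kernel-verified Lean document; each statement's English description precedes it below -/
import Mathlib

section
/- For every natural number n and every indexed family (f_i)_{i ∈ I} of functions f_i : ℕ → {0,1,2} with |I| = 3^n (repetitions allowed), there exists a subset S ⊆ I with |S| = n such that the set {f_i↾l : i ∈ S, l ∈ ℕ} of all finite initial segments of the functions f_i with i ∈ S is a 2-tree. -/
/-- A tree: a set of finite sequences of naturals closed under initial segments. -/
def IsTree (T : Set (List ℕ)) : Prop :=
  ∀ σ ∈ T, ∀ n : ℕ, σ.take n ∈ T

/-- The immediate successors of a node `σ` within `T`. -/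
def succs (T : Set (List ℕ)) (σ : List ℕ) : Set ℕ :=
  {m : ℕ | σ ++ [m] ∈ T}

/-- The set of all initial segments of a family of functions is a `k`-tree:
it is a tree (closed under initial segments) and every element has at most
`k` immediate successors within the set. -/
def IsInitSegKTree (k : ℕ) (T : Set (List ℕ)) : Prop :=
  IsTree T ∧ ∀ σ ∈ T, (succs T σ).encard ≤ k

/-- The initial segment `f↾n = ⟨f 0, …, f (n-1)⟩`. -/
def seg (f : ℕ → ℕ) (n : ℕ) : List ℕ :=
  List.ofFn fun i : Fin n => f i

/-- Three members of the family indexed by `S` that agree below `l` take at most two values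
at `l`. -/
def AtMostBinarySplitting {I : Type*} (f : I → ℕ → ℕ) (S : Finset I) : Prop :=
  ∀ i ∈ S, ∀ j ∈ S, ∀ k ∈ S, ∀ l : ℕ, (∀ t < l, f i t = f j t ∧ f i t = f k t) →
    f i l = f j l ∨ f i l = f k l ∨ f j l = f k l

theorem AtMostBinarySplitting.mono {I : Type*} {f : I → ℕ → ℕ} {S T : Finset I}
    (hT : AtMostBinarySplitting f T) (hST : S ⊆ T) : AtMostBinarySplitting f S :=
  fun i hi j hj k hk => hT i (hST hi) j (hST hj) k (hST hk)

theorem AtMostBinarySplitting.union {I : Type*} [DecidableEq I] {f : I → ℕ → ℕ} {S T : Finset I}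
    (hS : AtMostBinarySplitting f S) (hT : AtMostBinarySplitting f T) {l a b : ℕ} (hab : a ≠ b)
    (hSa : ∀ i ∈ S, f i l = a) (hTb : ∀ i ∈ T, f i l = b)
    (hl : ∀ t < l, ∀ i ∈ S ∪ T, ∀ j ∈ S ∪ T, f i t = f j t) :
    AtMostBinarySplitting f (S ∪ T) := by
  intro i hi j hj k hk m hm
  rcases lt_trichotomy m l with h | rfl | h
  · exact Or.inl (hl m h i hi j hj)
  · rw [Finset.mem_union] at hi hj hk
    grind
  · have hml := hm l h
    rw [Finset.mem_union] at hi hj hk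
    have key : (i ∈ S ∧ j ∈ S ∧ k ∈ S) ∨ (i ∈ T ∧ j ∈ T ∧ k ∈ T) := by grind
    rcases key with ⟨h1, h2, h3⟩ | ⟨h1, h2, h3⟩
    · exact hS i h1 j h2 k h3 m hm
    · exact hT i h1 j h2 k h3 m hm

theorem three_pow_add_le {x y z : ℕ} (hx : 1 ≤ x) (hy : 1 ≤ y) (hz : z ≤ x) :
    3 ^ x + 3 ^ y + 3 ^ z ≤ 3 ^ (x + y) := by
  have h1 : 3 ^ z ≤ 3 ^ x := Nat.pow_le_pow_right (by norm_num) hz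
  have h2 : 3 ^ 1 ≤ 3 ^ x := Nat.pow_le_pow_right (by norm_num) hx
  have h3 : 3 ^ 1 ≤ 3 ^ y := Nat.pow_le_pow_right (by norm_num) hy
  rw [pow_add]
  nlinarith

theorem exists_atMostBinarySplitting {I : Type*} (f : I → ℕ → ℕ) (hf : ∀ i m, f i m < 3)
    (F : Finset I) :
    ∃ S ⊆ F, F.card < 3 ^ S.card ∧ AtMostBinarySplitting f S := by
  classical
  induction F using Finset.strongInduction with
  | H F ih =>
  by_cases hF : ∃ l, ∃ i ∈ F, ∃ j ∈ F, f i l ≠ f j l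
  swap
  · push Not at hF
    exact ⟨F, subset_rfl, Nat.lt_pow_self (by norm_num),
      fun i hi j hj _ _ l _ => Or.inl (hF l i hi j hj)⟩
  obtain ⟨i₀, hi₀, j₀, hj₀, hne⟩ := Nat.find_spec hF
  have hmin := fun t (ht : t < Nat.find hF) => Nat.find_min hF ht
  generalize Nat.find hF = l at hne hmin
  push Not at hmin
  have hss : ∀ v, F.filter (fun i => f i l = v) ⊂ F := by
    intro v
    rw [Finset.filter_ssubset]
    by_cases h : f i₀ l = v
    · exact ⟨j₀, hj₀, fun h' => hne (h.trans h'.symm)⟩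
    · exact ⟨i₀, hi₀, h⟩
  choose S hSF hcard hS using fun v => ih _ (hss v)
  have hmem : ∀ v, ∀ i ∈ S v, i ∈ F ∧ f i l = v := fun v i hi =>
    Finset.mem_filter.1 (hSF v hi)
  have hpos : ∀ i ∈ F, 1 ≤ (S (f i l)).card := by
    intro i hi
    by_contra h
    have h0 : (S (f i l)).card = 0 := by omega
    have h1 := hcard (f i l)
    rw [h0, pow_zero, Nat.lt_one_iff, Finset.card_eq_zero] at h1
    exact Finset.notMem_empty i (h1 ▸ Finset.mem_filter.2 ⟨hi, rfl⟩)
  have hsum : F.card = ∑ v ∈ Finset.range 3, (F.filter (fun i => f i l = v)).card :=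
    Finset.card_eq_sum_card_fiberwise fun i _ => by simpa using hf i l
  simp only [Finset.sum_range_succ, Finset.sum_range_zero, zero_add] at hsum
  have combine : ∀ a b c : ℕ, a ≠ b → (∀ v < 3, v = a ∨ v = b ∨ v = c) →
      F.card = (F.filter (fun i => f i l = a)).card + (F.filter (fun i => f i l = b)).card
        + (F.filter (fun i => f i l = c)).card →
      (S c).card ≤ (S a).card → (S c).card ≤ (S b).card →
      ∃ T ⊆ F, F.card < 3 ^ T.card ∧ AtMostBinarySplitting f T := by
    intro a b c hab habc hF' hca hcb
    have hsub : S a ∪ S b ⊆ F :=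
      Finset.union_subset (fun i hi => (hmem a i hi).1) (fun i hi => (hmem b i hi).1)
    have hdisj : Disjoint (S a) (S b) := Finset.disjoint_left.2 fun i hi hi' =>
      hab ((hmem a i hi).2.symm.trans (hmem b i hi').2)
    have hp : 1 ≤ (S a).card ∧ 1 ≤ (S b).card := by
      have h1 := hpos i₀ hi₀
      have h2 := hpos j₀ hj₀
      rcases habc _ (hf i₀ l) with h | h | h <;> rcases habc _ (hf j₀ l) with h' | h' | h' <;>
        rw [h] at h1 hne <;> rw [h'] at h2 hne <;> first | exact absurd rfl hne | omega
    refine ⟨S a ∪ S b, hsub, ?_, (hS a).union (hS b) hab (fun i hi => (hmem a i hi).2)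
      (fun i hi => (hmem b i hi).2)
      fun t ht i hi j hj => hmin t ht i (hsub hi) j (hsub hj)⟩
    rw [Finset.card_union_of_disjoint hdisj]
    have := three_pow_add_le hp.1 hp.2 hca
    have := hcard a
    have := hcard b
    have := hcard c
    omega
  rcases le_total (S 0).card (S 1).card with h01 | h01 <;>
    rcases le_total (S 0).card (S 2).card with h02 | h02 <;>
    rcases le_total (S 1).card (S 2).card with h12 | h12 <;>
    first
    | exact combine 0 1 2 (by omega) (by omega) (by omega) (by omega) (by omega)
    | exact combine 0 2 1 (by omega) (by omega) (by omega) (by omega) (by omega)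
    | exact combine 1 2 0 (by omega) (by omega) (by omega) (by omega) (by omega)

theorem length_seg (g : ℕ → ℕ) (l : ℕ) : (seg g l).length = l := by
  simp [seg]

theorem take_seg (g : ℕ → ℕ) (l m : ℕ) : (seg g l).take m = seg g (min m l) := by
  apply List.ext_getElem <;> simp [seg]

theorem seg_succ (g : ℕ → ℕ) (l : ℕ) : seg g (l + 1) = seg g l ++ [g l] := by
  simp only [seg, List.ofFn_succ_last, Fin.val_castSucc, Fin.val_last]

theorem append_singleton_eq_seg_iff {g : ℕ → ℕ} {σ : List ℕ} {m l : ℕ} :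
    σ ++ [m] = seg g l ↔ l = σ.length + 1 ∧ σ = seg g σ.length ∧ m = g σ.length := by
  constructor
  · intro h
    obtain rfl : l = σ.length + 1 := by simpa [length_seg] using (congrArg List.length h).symm
    rw [seg_succ] at h
    have := List.append_inj h (length_seg g _).symm
    exact ⟨rfl, this.1, by simpa using this.2⟩
  · rintro ⟨rfl, h, rfl⟩
    rw [seg_succ, ← h]

theorem seg_inj {g h : ℕ → ℕ} {l : ℕ} : seg g l = seg h l ↔ ∀ t < l, g t = h t := by
  simp [seg, List.ofFn_inj, funext_iff, Fin.forall_iff]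

theorem AtMostBinarySplitting.isInitSegKTree {I : Type*} {f : I → ℕ → ℕ} {S : Finset I}
    (hS : AtMostBinarySplitting f S) :
    IsInitSegKTree 2 {σ : List ℕ | ∃ i ∈ S, ∃ l : ℕ, σ = seg (f i) l} := by
  constructor
  · rintro _ ⟨i, hi, l, rfl⟩ m
    exact ⟨i, hi, _, take_seg _ _ _⟩
  · intro σ _
    by_contra! hlt
    have hle : (3 : ℕ∞) ≤ (succs {σ | ∃ i ∈ S, ∃ l : ℕ, σ = seg (f i) l} σ).encard := by
      simpa [two_add_one_eq_three] using Order.add_one_le_of_lt hlt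
    obtain ⟨t, ht, ht3⟩ := Set.exists_subset_encard_eq hle
    obtain ⟨a, b, c, hab, hac, hbc, rfl⟩ := Set.encard_eq_three.1 ht3
    obtain ⟨i, hi, li, ha⟩ := ht (show a ∈ _ by simp)
    obtain ⟨j, hj, lj, hb⟩ := ht (show b ∈ _ by simp)
    obtain ⟨k, hk, lk, hc⟩ := ht (show c ∈ _ by simp)
    rw [append_singleton_eq_seg_iff] at ha hb hc
    have hij := seg_inj.1 (ha.2.1.symm.trans hb.2.1)
    have hik := seg_inj.1 (ha.2.1.symm.trans hc.2.1)
    have := hS i hi j hj k hk σ.length fun t ht => ⟨hij t ht, hik t ht⟩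
    rw [← ha.2.2, ← hb.2.2, ← hc.2.2] at this
    tauto

theorem stmt0 (n : ℕ) (I : Type) [Fintype I] (hI : Fintype.card I = 3 ^ n)
    (f : I → ℕ → ℕ) (hf : ∀ i m, f i m < 3) :
    ∃ S : Finset I, S.card = n ∧
      IsInitSegKTree 2 {σ : List ℕ | ∃ i ∈ S, ∃ l : ℕ, σ = seg (f i) l} := by
  obtain ⟨T, -, hcard, hT⟩ := exists_atMostBinarySplitting f hf Finset.univ
  rw [Finset.card_univ, hI] at hcard
  obtain ⟨S, hST, rfl⟩ := Finset.exists_subset_card_eq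
    ((Nat.pow_lt_pow_iff_right (by norm_num)).1 hcard).le
  exact ⟨S, rfl, (hT.mono hST).isInitSegKTree⟩
end

section
/- For every natural number n, every natural number M, and every indexed family (f_i)_{i ∈ I} of finite sequences f_i ∈ {0,1,2}^M with |I| = 3^n (repetitions allowed), there exists a subset S ⊆ I with |S| = n such that the set {f_i↾l : i ∈ S, l ≤ M} of all initial segments of the sequences f_i with i ∈ S is a 2-tree. -/
/-- Every node omits one of the three possible immediate successors among the sequences
`f i`, `i ∈ S`. -/
def OmitsSuccessors {I : Type*} (f : I → List ℕ) (S : Finset I) : Prop :=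
  ∀ σ : List ℕ, ∃ c < 3, ∀ i ∈ S, ¬ σ ++ [c] <+: f i

/-- A single sequence passes through at most one immediate successor of a node. -/
lemma exists_lt_three_not_prefix (σ τ : List ℕ) : ∃ c < 3, ¬ σ ++ [c] <+: τ := by
  by_contra! h
  have h01 := List.prefix_of_prefix_length_le (h 0 (by omega)) (h 1 (by omega)) (by simp)
  simp at h01

/-- Prepending a common first entry to all sequences preserves `OmitsSuccessors`. -/
lemma OmitsSuccessors.cons {I : Type*} {f : I → List ℕ} {S : Finset I} {c : ℕ}
    (hf : ∀ i ∈ S, f i = c :: (f i).tail)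
    (hS : OmitsSuccessors (fun i => (f i).tail) S) : OmitsSuccessors f S := by
  rintro (_ | ⟨x, τ⟩)
  · obtain ⟨d, hd, hdc⟩ : ∃ d < 3, d ≠ c := by
      by_cases h : c = 0
      · exact ⟨1, by omega, by omega⟩
      · exact ⟨0, by omega, by omega⟩
    refine ⟨d, hd, fun i hi hp => hdc ?_⟩
    rw [hf i hi] at hp
    simpa using hp
  · obtain ⟨d, hd, h⟩ := hS τ
    refine ⟨d, hd, fun i hi hp => h i hi ?_⟩
    rw [hf i hi, List.cons_append, List.cons_prefix_cons] at hp
    exact hp.2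

/-- Adding one sequence with a different first entry preserves `OmitsSuccessors` for a family of
sequences with a common first entry. -/
lemma OmitsSuccessors.insert {I : Type*} [DecidableEq I] {f : I → List ℕ} {S : Finset I} {c d : ℕ}
    {j : I} (hf : ∀ i ∈ S, f i = c :: (f i).tail) (hj : f j = d :: (f j).tail) (hdc : d ≠ c)
    (hS : OmitsSuccessors f S) : OmitsSuccessors f (insert j S) := by
  rintro (_ | ⟨x, τ⟩)
  · obtain ⟨e, he, hec, hed⟩ : ∃ e < 3, e ≠ c ∧ e ≠ d := by
      by_contra! h
      have h0 := h 0
      have h1 := h 1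
      have h2 := h 2
      omega
    refine ⟨e, he, fun i hi hp => ?_⟩
    rcases Finset.mem_insert.mp hi with rfl | hi
    · rw [hj] at hp
      exact hed (by simpa using hp)
    · rw [hf i hi] at hp
      exact hec (by simpa using hp)
  · by_cases hx : x = c
    · obtain ⟨e, he, h⟩ := hS (x :: τ)
      refine ⟨e, he, fun i hi hp => ?_⟩
      rcases Finset.mem_insert.mp hi with rfl | hi
      · rw [hj, List.cons_append, List.cons_prefix_cons] at hp
        exact hdc (hp.1.symm.trans hx)
      · exact h i hi hp
    · obtain ⟨e, he, h⟩ := exists_lt_three_not_prefix (x :: τ) (f j)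
      refine ⟨e, he, fun i hi hp => ?_⟩
      rcases Finset.mem_insert.mp hi with rfl | hi
      · exact h hp
      · rw [hf i hi, List.cons_append, List.cons_prefix_cons] at hp
        exact hx hp.1

/-- Among `3 ^ n` ternary sequences of equal length there are `n` indices whose sequences omit a
successor at every node. -/
lemma exists_card_eq_omitsSuccessors {I : Type*} (M : ℕ) :
    ∀ (n : ℕ) (f : I → List ℕ) (A : Finset I), (∀ i ∈ A, (f i).length = M) →
      (∀ i ∈ A, ∀ x ∈ f i, x < 3) → 3 ^ n ≤ A.card →
      ∃ S ⊆ A, S.card = n ∧ OmitsSuccessors f S := by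
  classical
  induction M with
  | zero =>
    intro n f A hlen _ hA
    obtain ⟨S, hSA, hS⟩ :=
      Finset.exists_subset_card_eq ((Nat.lt_pow_self (by omega : 1 < 3)).le.trans hA)
    refine ⟨S, hSA, hS, fun σ => ⟨0, by omega, fun i hi hp => ?_⟩⟩
    have := hp.length_le
    simp [hlen i (hSA hi)] at this
  | succ M ih =>
    rintro (_ | n) f A hlen hval hA
    · exact ⟨∅, by simp, rfl, fun σ => ⟨0, by omega, by simp⟩⟩
    have hcons : ∀ i ∈ A, f i = (f i).headI :: (f i).tail := fun i hi => by
      have := hlen i hi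
      cases h : f i <;> simp_all
    have hhead : ∀ i ∈ A, (f i).headI ∈ Finset.range 3 := fun i hi => by
      rw [Finset.mem_range]
      apply hval i hi
      rw [hcons i hi]
      simp
    obtain ⟨c, -, hc⟩ := Finset.exists_le_card_fiber_of_mul_le_card_of_maps_to hhead
      (n := 3 ^ n) (by simp) (by rw [Finset.card_range, ← pow_succ']; exact hA)
    set B := A.filter fun i => (f i).headI = c
    have hBA : B ⊆ A := Finset.filter_subset _ _
    have hBcons : ∀ i ∈ B, f i = c :: (f i).tail := fun i hi => by
      rw [← (Finset.mem_filter.mp hi).2]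
      exact hcons i (hBA hi)
    have key : ∀ m, 3 ^ m ≤ B.card → ∃ S ⊆ B, S.card = m ∧ OmitsSuccessors f S := by
      intro m hm
      obtain ⟨S, hSB, hS, hgood⟩ := ih m (fun i => (f i).tail) B
        (fun i hi => by simp [hlen i (hBA hi)])
        (fun i hi x hx => hval i (hBA hi) x (List.mem_of_mem_tail hx)) hm
      exact ⟨S, hSB, hS, hgood.cons fun i hi => hBcons i (hSB hi)⟩
    by_cases hAB : A ⊆ B
    · obtain ⟨S, hSB, h⟩ := key (n + 1) (hA.trans (Finset.card_le_card hAB))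
      exact ⟨S, hSB.trans hBA, h⟩
    · obtain ⟨j, hjA, hjB⟩ := Finset.not_subset.mp hAB
      obtain ⟨S, hSB, hS, hgood⟩ := key n hc
      refine ⟨insert j S, Finset.insert_subset hjA (hSB.trans hBA), ?_,
        hgood.insert (fun i hi => hBcons i (hSB hi)) (hcons j hjA)
          fun h => hjB (Finset.mem_filter.mpr ⟨hjA, h⟩)⟩
      rw [Finset.card_insert_of_notMem fun h => hjB (hSB h), hS]

theorem stmt1 (n M : ℕ) (I : Type) [Fintype I] (hI : Fintype.card I = 3 ^ n)
    (f : I → List ℕ) (hlen : ∀ i, (f i).length = M)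
    (hval : ∀ i, ∀ x ∈ f i, x < 3) :
    ∃ S : Finset I, S.card = n ∧
      IsInitSegKTree 2 {σ : List ℕ | ∃ i ∈ S, ∃ l ≤ M, σ = (f i).take l} := by
  obtain ⟨S, -, hS, hgood⟩ := exists_card_eq_omitsSuccessors M n f Finset.univ
    (fun i _ => hlen i) (fun i _ => hval i) hI.ge
  refine ⟨S, hS, ?_, fun σ _ => ?_⟩
  · rintro _ ⟨i, hi, l, hl, rfl⟩ m
    exact ⟨i, hi, min m l, (min_le_right _ _).trans hl, List.take_take⟩
  · obtain ⟨c, hc, h⟩ := hgood σ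
    have hsub : succs {σ : List ℕ | ∃ i ∈ S, ∃ l ≤ M, σ = (f i).take l} σ ⊆
        ((Finset.range 3).erase c : Finset ℕ) := by
      rintro m ⟨i, hi, l, -, hm⟩
      have hp : σ ++ [m] <+: f i := hm ▸ List.take_prefix l (f i)
      rw [Finset.mem_coe, Finset.mem_erase, Finset.mem_range]
      exact ⟨fun hmc => h i hi (hmc ▸ hp), hval i m (hp.subset (by simp))⟩
    refine (Set.encard_le_encard hsub).trans ?_
    rw [Set.encard_coe_eq_coe_finsetCard, Finset.card_erase_of_mem (Finset.mem_range.mpr hc)]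
    simp
end

section
/- For every k ≥ 1 and every k globally adaptive predictor π, there exists a countable family 𝒯 of k-trees (subtrees of the set of finite sequences of natural numbers) such that every function f : ℕ → ℕ that is predicted by π is a branch of some tree in 𝒯. -/
/-- A `k`-tree: a tree in which every node has at least `1` and at most `k`
immediate successors. -/
def IsKTree (k : ℕ) (T : Set (List ℕ)) : Prop :=
  IsTree T ∧ ∀ σ ∈ T, 1 ≤ (succs T σ).encard ∧ (succs T σ).encard ≤ k

/-- `f` is a branch of `T` if all its finite initial segments belong to `T`. -/
def IsBranch (T : Set (List ℕ)) (f : ℕ → ℕ) : Prop :=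
  ∀ n : ℕ, seg f n ∈ T

/-- A `k` globally adaptive predictor: a sequence `⟨π_n : n ∈ ℕ⟩` of functions,
where `π_n` assigns to each sequence `s ∈ ℕ^n` a `k`-element set of naturals. -/
structure Predictor (k : ℕ) where
  π : (n : ℕ) → (Fin n → ℕ) → Finset ℕ
  card_π : ∀ n s, (π n s).card = k

/-- `f` is predicted by `p` if from some point on, `f n ∈ π_n (f↾n)`. -/
def Predicts {k : ℕ} (p : Predictor k) (f : ℕ → ℕ) : Prop :=
  ∃ m : ℕ, ∀ n : ℕ, m < n → f n ∈ p.π n fun i : Fin n => f i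

/-- The tree of all sequences whose every entry lies in the set that `F` assigns to the
preceding initial segment. -/
def treeOf (F : List ℕ → Finset ℕ) : Set (List ℕ) :=
  {σ | ∀ n (h : n < σ.length), σ[n] ∈ F (σ.take n)}

theorem isTree_treeOf (F : List ℕ → Finset ℕ) : IsTree (treeOf F) := by
  intro σ hσ n i hi
  have hi' : i < n ∧ i < σ.length := by simpa using hi
  have h := hσ i hi'.2
  rw [List.getElem_take, List.take_take, min_eq_left hi'.1.le]
  exact h

theorem succs_treeOf {F : List ℕ → Finset ℕ} {σ : List ℕ} (hσ : σ ∈ treeOf F) :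
    succs (treeOf F) σ = F σ := by
  ext m
  constructor
  · intro h
    simpa using h σ.length (by simp)
  · intro hm i hi
    rcases lt_or_eq_of_le (Nat.lt_succ_iff.mp (by simpa using hi)) with h | rfl
    · rw [List.getElem_append_left h, List.take_append_of_le_length h.le]
      exact hσ i h
    · simpa using hm

theorem isKTree_treeOf {k : ℕ} {F : List ℕ → Finset ℕ}
    (hF : ∀ σ, 1 ≤ (F σ).card ∧ (F σ).card ≤ k) : IsKTree k (treeOf F) := by
  refine ⟨isTree_treeOf F, fun σ hσ => ?_⟩
  rw [succs_treeOf hσ, Set.encard_coe_eq_coe_finsetCard]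
  exact_mod_cast hF σ

/-- Follow the stem `s` as long as possible, then follow the predictor `p`. -/
def stemThenPredict {k : ℕ} (p : Predictor k) (s σ : List ℕ) : Finset ℕ :=
  if σ.length < s.length then {s.getD σ.length 0}
  else p.π σ.length fun i => σ.getD i 0

theorem card_stemThenPredict {k : ℕ} (hk : 1 ≤ k) (p : Predictor k) (s σ : List ℕ) :
    1 ≤ (stemThenPredict p s σ).card ∧ (stemThenPredict p s σ).card ≤ k := by
  unfold stemThenPredict
  split_ifs
  · simpa using hk
  · simpa [p.card_π] using hk

theorem length_seg_s5 (f : ℕ → ℕ) (n : ℕ) : (seg f n).length = n := by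
  simp [seg]

theorem getD_seg (f : ℕ → ℕ) {i n : ℕ} (h : i < n) : (seg f n).getD i 0 = f i := by
  simp [seg, h]

theorem take_seg_s5 (f : ℕ → ℕ) {i n : ℕ} (h : i ≤ n) : (seg f n).take i = seg f i := by
  apply List.ext_getElem
  · simp [seg, h]
  · simp [seg]

theorem isBranch_treeOf {F : List ℕ → Finset ℕ} {f : ℕ → ℕ} (h : ∀ n, f n ∈ F (seg f n)) :
    IsBranch (treeOf F) f := by
  intro n i hi
  rw [take_seg_s5 f (length_seg_s5 f n ▸ hi.le)]
  simpa [seg] using h i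

theorem predictor_seg {k : ℕ} (p : Predictor k) (f : ℕ → ℕ) (n : ℕ) :
    (p.π (seg f n).length fun i => (seg f n).getD i 0) = p.π n fun i => f i := by
  have key : ∀ N, N = n →
      (p.π N fun i : Fin N => (seg f n).getD i 0) = p.π n fun i => f i := by
    rintro _ rfl
    congr 1
    funext i
    exact getD_seg f i.isLt
  exact key _ (length_seg_s5 f n)

theorem stmt5 (k : ℕ) (hk : 1 ≤ k) (p : Predictor k) :
    ∃ 𝒯 : Set (Set (List ℕ)), 𝒯.Countable ∧ (∀ T ∈ 𝒯, IsKTree k T) ∧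
      ∀ f : ℕ → ℕ, Predicts p f → ∃ T ∈ 𝒯, IsBranch T f := by
  refine ⟨Set.range fun s => treeOf (stemThenPredict p s), Set.countable_range _, ?_, ?_⟩
  · rintro _ ⟨s, rfl⟩
    exact isKTree_treeOf (card_stemThenPredict hk p s)
  · rintro f ⟨m, hm⟩
    refine ⟨_, ⟨seg f (m + 1), rfl⟩, isBranch_treeOf fun n => ?_⟩
    unfold stemThenPredict
    split_ifs with h
    · simp only [length_seg_s5] at h ⊢
      rw [getD_seg f h]
      exact Finset.mem_singleton_self _
    · rw [predictor_seg]
      simp only [length_seg_s5] at h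
      exact hm n (by omega)
end

section
/- Let 2 ≤ s ≤ k and let f : {0,…,k} → {0,…,s} be a surjection; let f* denote the map applying f pointwise to finite sequences with values in {0,…,k}. If T is an s-tree all of whose nodes are sequences with values in {0,…,s}, then T' = {σ : σ is a finite sequence with values in {0,…,k} and f*(σ) ∈ T} is a k-tree, and a function g : ℕ → {0,…,k} is a branch of T' if and only if f∘g is a branch of T. -/
theorem map_seg (f g : ℕ → ℕ) (n : ℕ) : (seg g n).map f = seg (f ∘ g) n := by
  simp [seg, List.map_ofFn, Function.comp_def]

theorem Set.encard_Iic_diff_singleton {k x : ℕ} (hx : x ≤ k) :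
    (Set.Iic k \ {x}).encard = k := by
  have h : (Set.Iic k \ {x} : Set ℕ) = ((Finset.Iic k).erase x : Finset ℕ) := by
    ext m
    simp
  rw [h, Set.encard_coe_eq_coe_finsetCard, Finset.card_erase_of_mem (by simpa using hx)]
  simp

theorem exists_le_notMem_of_encard_le {s : ℕ} {A : Set ℕ} (hA : A.encard ≤ s) :
    ∃ y ≤ s, y ∉ A := by
  by_contra! h
  have hle : (Set.Iic s).encard ≤ s := (Set.encard_le_encard h).trans hA
  rw [← Finset.coe_Iic, Set.encard_coe_eq_coe_finsetCard, Nat.card_Iic] at hle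
  exact absurd (Nat.cast_le.mp hle) (by omega)

theorem stmt11 (s k : ℕ) (hs : 2 ≤ s) (hsk : s ≤ k) (f : ℕ → ℕ)
    (hmap : ∀ x ≤ k, f x ≤ s) (hsurj : ∀ y ≤ s, ∃ x ≤ k, f x = y)
    (T : Set (List ℕ)) (hT : IsKTree s T) (hTval : ∀ σ ∈ T, ∀ x ∈ σ, x ≤ s) :
    IsKTree k {σ : List ℕ | (∀ x ∈ σ, x ≤ k) ∧ σ.map f ∈ T} ∧
      ∀ g : ℕ → ℕ, (∀ n, g n ≤ k) →
        (IsBranch {σ : List ℕ | (∀ x ∈ σ, x ≤ k) ∧ σ.map f ∈ T} g ↔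
          IsBranch T (f ∘ g)) := by
  obtain ⟨hTree, hsucc⟩ := hT
  refine ⟨⟨?_, ?_⟩, ?_⟩
  · rintro σ ⟨hσ, hσT⟩ n
    refine ⟨fun x hx => hσ x (List.mem_of_mem_take hx), ?_⟩
    rw [List.map_take]
    exact hTree _ hσT n
  · rintro σ ⟨hσ, hσT⟩
    obtain ⟨h1, h2⟩ := hsucc _ hσT
    have hmem : ∀ m, m ∈ succs {σ : List ℕ | (∀ x ∈ σ, x ≤ k) ∧ σ.map f ∈ T} σ ↔
        m ≤ k ∧ f m ∈ succs T (σ.map f) := by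
      intro m
      simp only [succs, Set.mem_ofPred_eq, List.map_append, List.map_cons, List.map_nil,
        List.mem_append, List.mem_singleton]
      exact ⟨fun h => ⟨h.1 m (Or.inr rfl), h.2⟩,
        fun h => ⟨fun x hx => hx.elim (hσ x) (fun e => e ▸ h.1), h.2⟩⟩
    constructor
    · rw [Set.one_le_encard_iff_nonempty] at h1 ⊢
      obtain ⟨y, hy⟩ := h1
      obtain ⟨x, hx, rfl⟩ := hsurj y (hTval _ hy y (by simp))
      exact ⟨x, (hmem x).2 ⟨hx, hy⟩⟩
    · obtain ⟨y, hys, hy⟩ := exists_le_notMem_of_encard_le h2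
      obtain ⟨x, hx, rfl⟩ := hsurj y hys
      rw [← Set.encard_Iic_diff_singleton hx]
      refine Set.encard_le_encard fun m hm => ?_
      rw [hmem] at hm
      refine ⟨hm.1, ?_⟩
      rintro rfl
      exact hy hm.2
  · intro g hg
    refine forall_congr' fun n => ?_
    rw [Set.mem_ofPred_eq, map_seg]
    refine and_iff_right fun x hx => ?_
    obtain ⟨i, rfl⟩ := List.mem_ofFn.mp hx
    exact hg i
end

section
/- Let 2 ≤ s ≤ k and let λ be a cardinal. If there is a family of cardinality λ of s-trees (trees of finite sequences with values in {0,…,s}) such that every function g : ℕ → {0,…,s} is a branch of some tree in the family, then there is a family of cardinality at most λ of k-trees (trees of finite sequences with values in {0,…,k}) such that every function h : ℕ → {0,…,k} is a branch of some tree in that family. -/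
/-- The sequences with values at most `k` whose truncation at `s` lies in `T`. -/
def truncLift (s k : ℕ) (T : Set (List ℕ)) : Set (List ℕ) :=
  {σ | (∀ x ∈ σ, x ≤ k) ∧ σ.map (min s) ∈ T}

theorem succs_truncLift_subset (s k : ℕ) (T : Set (List ℕ)) (σ : List ℕ) :
    succs (truncLift s k T) σ ⊆ succs T (σ.map (min s)) ∪ Set.Ioc s k := by
  rintro m ⟨hm, hT⟩
  rcases le_or_gt m s with h | h
  · left
    simpa [succs, min_eq_right h] using hT
  · exact Or.inr ⟨h, hm m (by simp)⟩

theorem IsKTree.truncLift {s k : ℕ} (hsk : s ≤ k) {T : Set (List ℕ)} (hT : IsKTree s T)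
    (hb : ∀ σ ∈ T, ∀ x ∈ σ, x ≤ s) : IsKTree k (truncLift s k T) := by
  refine ⟨fun σ hσ n => ⟨fun x hx => hσ.1 x (List.mem_of_mem_take hx), ?_⟩, fun σ hσ => ⟨?_, ?_⟩⟩
  · rw [List.map_take]
    exact hT.1 _ hσ.2 n
  · obtain ⟨m, hm⟩ := Set.one_le_encard_iff_nonempty.1 (hT.2 _ hσ.2).1
    have hms : m ≤ s := hb _ hm m (by simp)
    refine Set.one_le_encard_iff_nonempty.2 ⟨m, fun x hx => ?_, ?_⟩
    · rcases List.mem_append.1 hx with hx | hx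
      · exact hσ.1 x hx
      · exact (List.mem_singleton.1 hx).trans_le (hms.trans hsk)
    · simpa [succs, min_eq_right hms] using hm
  · calc (succs (_root_.truncLift s k T) σ).encard
        ≤ (succs T (σ.map (min s)) ∪ Set.Ioc s k).encard :=
          Set.encard_le_encard (succs_truncLift_subset s k T σ)
      _ ≤ (succs T (σ.map (min s))).encard + (Set.Ioc s k).encard := Set.encard_union_le _ _
      _ ≤ s + (k - s : ℕ) := by
          gcongr
          · exact (hT.2 _ hσ.2).2
          · rw [← Finset.coe_Ioc, Set.encard_coe_eq_coe_finsetCard, Nat.card_Ioc]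
      _ = k := by exact_mod_cast Nat.add_sub_cancel' hsk

theorem IsBranch.truncLift {s k : ℕ} {T : Set (List ℕ)} {g : ℕ → ℕ} (hg : ∀ n, g n ≤ k)
    (h : IsBranch T fun n => min s (g n)) : IsBranch (truncLift s k T) g := by
  refine fun n => ⟨fun x hx => ?_, ?_⟩
  · obtain ⟨i, rfl⟩ := (List.mem_ofFn' _ _).1 hx
    exact hg i
  · simpa [seg, List.map_ofFn, Function.comp_def] using h n

theorem stmt12 (s k : ℕ) (hs : 2 ≤ s) (hsk : s ≤ k) (lam : Cardinal)
    (hcov : ∃ 𝒯 : Set (Set (List ℕ)), Cardinal.mk 𝒯 = lam ∧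
      (∀ T ∈ 𝒯, IsKTree s T ∧ ∀ σ ∈ T, ∀ x ∈ σ, x ≤ s) ∧
      ∀ g : ℕ → ℕ, (∀ n, g n ≤ s) → ∃ T ∈ 𝒯, IsBranch T g) :
    ∃ 𝒯' : Set (Set (List ℕ)), Cardinal.mk 𝒯' ≤ lam ∧
      (∀ T ∈ 𝒯', IsKTree k T ∧ ∀ σ ∈ T, ∀ x ∈ σ, x ≤ k) ∧
      ∀ g : ℕ → ℕ, (∀ n, g n ≤ k) → ∃ T ∈ 𝒯', IsBranch T g := by
  obtain ⟨𝒯, rfl, hT, hc⟩ := hcov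
  refine ⟨truncLift s k '' 𝒯, Cardinal.mk_image_le, ?_, fun g hg => ?_⟩
  · rintro _ ⟨T, hmem, rfl⟩
    exact ⟨(hT T hmem).1.truncLift hsk (hT T hmem).2, fun σ hσ => hσ.1⟩
  · obtain ⟨T, hmem, hbr⟩ := hc (fun n => min s (g n)) fun n => min_le_left _ _
    exact ⟨_, ⟨T, hmem, rfl⟩, hbr.truncLift hg⟩
end

section
/- Let T be an accelerating tree. Then for every k ≥ 1 and every k-tree U (a subtree of the set of finite sequences of natural numbers), there exists a node ρ ∈ T with ρ ∉ U; consequently, no branch of T whose initial segments include ρ is a branch of U. -/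
/-- A splitting node: a node with at least `2` immediate successors in `T`. -/
def IsSplitting (T : Set (List ℕ)) (σ : List ℕ) : Prop :=
  2 ≤ (succs T σ).encard

/-- The number of proper initial segments of `σ` that are splitting nodes of `T`. -/
noncomputable def splitCount (T : Set (List ℕ)) (σ : List ℕ) : ℕ :=
  {j : ℕ | j < σ.length ∧ IsSplitting T (σ.take j)}.ncard

/-- An accelerating tree: a nonempty tree of finite sequences `σ` with
`σ(n) ≤ n`, in which every node has a splitting extension, and every node with
exactly `n` splitting proper initial segments has either exactly `1` or at
least `n + 2` immediate successors. -/
def IsAccelerating (T : Set (List ℕ)) : Prop :=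
  T.Nonempty ∧ IsTree T ∧
  (∀ σ ∈ T, ∀ i : Fin σ.length, σ.get i ≤ (i : ℕ)) ∧
  (∀ σ ∈ T, ∃ τ ∈ T, σ <+: τ ∧ IsSplitting T τ) ∧
  (∀ σ ∈ T, (succs T σ).encard = 1 ∨
    ((splitCount T σ : ℕ∞) + 2) ≤ (succs T σ).encard)

theorem splitCount_lt_of_prefix {T : Set (List ℕ)} {σ τ : List ℕ} {m : ℕ}
    (hσ : IsSplitting T σ) (hτ : σ ++ [m] <+: τ) : splitCount T σ < splitCount T τ := by
  obtain ⟨ρ, rfl⟩ := hτ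
  have htake : ∀ j ≤ σ.length, (σ ++ [m] ++ ρ).take j = σ.take j := fun j hj => by
    rw [List.append_assoc, List.take_append_of_le_length hj]
  refine Set.ncard_lt_ncard ⟨?_, fun hsub => ?_⟩
    ((Set.finite_lt_nat (σ ++ [m] ++ ρ).length).subset fun j hj => hj.1)
  · rintro j ⟨hj, hs⟩
    refine ⟨by simp; omega, ?_⟩
    rwa [htake j hj.le]
  · refine lt_irrefl _ (hsub (a := σ.length) ⟨by simp, ?_⟩).1
    rwa [htake _ le_rfl, List.take_length]

theorem IsAccelerating.exists_isSplitting_le_splitCount {T : Set (List ℕ)}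
    (hT : IsAccelerating T) (n : ℕ) : ∃ σ ∈ T, IsSplitting T σ ∧ n ≤ splitCount T σ := by
  obtain ⟨⟨σ₀, hσ₀⟩, -, -, hext, -⟩ := hT
  induction n with
  | zero =>
    obtain ⟨τ, hτ, -, hs⟩ := hext σ₀ hσ₀
    exact ⟨τ, hτ, hs, Nat.zero_le _⟩
  | succ n ih =>
    obtain ⟨σ, -, hs, hn⟩ := ih
    obtain ⟨m, hm⟩ : (succs T σ).Nonempty := by
      rw [← Set.encard_pos]
      exact lt_of_lt_of_le (by norm_num) hs
    obtain ⟨τ, hτ, hpre, hsτ⟩ := hext _ hm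
    exact ⟨τ, hτ, hsτ, hn.trans_lt (splitCount_lt_of_prefix hs hpre)⟩

theorem IsAccelerating.not_subset_of_isKTree {T U : Set (List ℕ)} {k : ℕ}
    (hT : IsAccelerating T) (hU : IsKTree k U) : ¬ T ⊆ U := by
  intro hTU
  obtain ⟨σ, hσ, hs, hk⟩ := hT.exists_isSplitting_le_splitCount k
  have hle : (succs T σ).encard ≤ k :=
    (Set.encard_le_encard (show succs T σ ⊆ succs U σ from fun _ hm => hTU hm)).trans
      (hU.2 σ (hTU hσ)).2
  rcases hT.2.2.2.2 σ hσ with h | h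
  · rw [IsSplitting, h] at hs
    norm_num at hs
  · have : splitCount T σ + 2 ≤ k := by exact_mod_cast h.trans hle
    omega

theorem stmt17 (T : Set (List ℕ)) (hT : IsAccelerating T)
    (k : ℕ) (hk : 1 ≤ k) (U : Set (List ℕ)) (hU : IsKTree k U) :
    ∃ ρ ∈ T, ρ ∉ U ∧
      ∀ f : ℕ → ℕ, IsBranch T f → (∃ n, seg f n = ρ) → ¬ IsBranch U f := by
  obtain ⟨ρ, hρT, hρU⟩ := Set.not_subset.1 (hT.not_subset_of_isKTree hU)
  exact ⟨ρ, hρT, hρU, fun f _ ⟨n, hn⟩ hf => hρU (hn ▸ hf n)⟩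
end
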